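/- Under assumptions (A.1)–(A.4), let G* be a Softmax–Softmax Gaussian HMoE mixing measure with k₁* groups and k₂* experts per group, let (X₁,Y₁),…,(Xₙ,Yₙ) be i.i.d. with each Xᵢ distributed according to a probability measure μ on ℝ^d with bounded support and Yᵢ given Xᵢ = x distributed with density p^SS_{G*}(·|x), and for k₂ > k₂* let Ĝₙ be any maximizer over G ∈ 𝒢_{k₁*,k₂}(Θ) of the empirical log-likelihood (1/n)·Σ_{i=1}^n log p^SS_G(Yᵢ|Xᵢ). Then there exist universal constants C₁, c₁, C₂ > 0 such that for every n ≥ 2, the probability that E_{X∼μ}[ h(p^SS_{Ĝₙ}(·|X), p^SS_{G*}(·|X)) ] > C₁·√(log n / n) is at most C₂·exp(−c₁·log n). -/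

import Mathlib

open scoped RealInnerProductSpace

noncomputable section

/-- Euclidean input space `ℝ^d`. -/
abbrev Euc (d : ℕ) := EuclideanSpace ℝ (Fin d)

/-- Univariate Gaussian density `π(y|μ,ν) = (2πν)^(-1/2) exp(-(y-μ)²/(2ν))`. -/
def gaussPDF (m v y : ℝ) : ℝ :=
  (Real.sqrt (2 * Real.pi * v))⁻¹ * Real.exp (-(y - m) ^ 2 / (2 * v))

/-- Parameters of a two-level Gaussian HMoE with `k1` groups and `k2` experts per group:
first-level gating parameters `(b_{i₁}, a_{i₁})`, second-level gating parameters
`(β_{i₂|i₁}, ω_{i₂|i₁})`, and expert parameters `(η_{i₁i₂}, τ_{i₁i₂}, ν_{i₁i₂})`. -/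
structure HMoE (d k1 k2 : ℕ) where
  b : Fin k1 → ℝ
  a : Fin k1 → Euc d
  β : Fin k1 → Fin k2 → ℝ
  ω : Fin k1 → Fin k2 → Euc d
  η : Fin k1 → Fin k2 → Euc d
  τ : Fin k1 → Fin k2 → ℝ
  ν : Fin k1 → Fin k2 → ℝ

/-- Conditional density of the Softmax–Softmax Gaussian HMoE. -/
def pSS {d k1 k2 : ℕ} (P : HMoE d k1 k2) (x : Euc d) (y : ℝ) : ℝ :=
  ∑ i1, (Real.exp (⟪P.a i1, x⟫ + P.b i1) /
      ∑ j1, Real.exp (⟪P.a j1, x⟫ + P.b j1)) *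
    ∑ i2, (Real.exp (⟪P.ω i1 i2, x⟫ + P.β i1 i2) /
        ∑ j2, Real.exp (⟪P.ω i1 j2, x⟫ + P.β i1 j2)) *
      gaussPDF (⟪P.η i1 i2, x⟫ + P.τ i1 i2) (P.ν i1 i2) y

open MeasureTheory

/-- All parameter tuples `(b, a, β, ω, η, τ, ν)` of `P` lie in the parameter space `Θ`. -/
def inParamSpace {d k1 k2 : ℕ}
    (Θ : Set (ℝ × Euc d × ℝ × Euc d × Euc d × ℝ × ℝ)) (P : HMoE d k1 k2) : Prop :=
  ∀ i1 i2, (P.b i1, P.a i1, P.β i1 i2, P.ω i1 i2, P.η i1 i2, P.τ i1 i2, P.ν i1 i2) ∈ Θ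

/-- A candidate mixing measure with `k1` groups and an arbitrary number of experts per
group (encoded by the first component). -/
def Candidate (d k1 : ℕ) := Σ k2' : ℕ, HMoE d k1 k2'

/-- The class `𝒢_{k1,k2}(Θ)` of candidate mixing measures: at most `k2` (and at least one)
experts per group, with all parameters in `Θ`. -/
def candClass (d k1 k2 : ℕ) (Θ : Set (ℝ × Euc d × ℝ × Euc d × Euc d × ℝ × ℝ)) :
    Set (Candidate d k1) :=
  {c | 1 ≤ c.1 ∧ c.1 ≤ k2 ∧ inParamSpace Θ c.2}

/-- Hellinger distance between two conditional densities on `ℝ`: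
`h(p, q) = ( (1/2) ∫ (√p − √q)² )^{1/2}`. -/
def hellingerDist (p q : ℝ → ℝ) : ℝ :=
  Real.sqrt ((1 / 2) * ∫ y : ℝ, (Real.sqrt (p y) - Real.sqrt (q y)) ^ 2)

/-- Joint distribution of a pair `(X, Y)` where `X ∼ μ` and `Y | X = x` has Lebesgue
density `p x ·`. -/
def jointMeasure {d : ℕ} (μ : Measure (Euc d)) (p : Euc d → ℝ → ℝ) :
    Measure (Euc d × ℝ) :=
  (μ.prod volume).withDensity fun z => ENNReal.ofReal (p z.1 z.2)

/-! ### Analytic lemmas -/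

lemma aux_softmax {k : ℕ} (u u' : Fin k → ℝ) (t : ℝ) (h : ∀ i, |u i - u' i| ≤ t) (i : Fin k) :
    Real.exp (u i) / ∑ j, Real.exp (u j) ≤
      (Real.exp (u' i) / ∑ j, Real.exp (u' j)) * Real.exp (2 * t) := by
  have hne : (Finset.univ : Finset (Fin k)).Nonempty := ⟨i, Finset.mem_univ i⟩
  have hS : 0 < ∑ j, Real.exp (u j) := Finset.sum_pos (fun j _ => Real.exp_pos _) hne
  have hS' : 0 < ∑ j, Real.exp (u' j) := Finset.sum_pos (fun j _ => Real.exp_pos _) hne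
  have h1 : Real.exp (u i) ≤ Real.exp (u' i) * Real.exp t := by
    rw [← Real.exp_add]
    exact Real.exp_le_exp.2 (by have := (abs_le.1 (h i)).2; linarith)
  have h2 : ∑ j, Real.exp (u' j) ≤ (∑ j, Real.exp (u j)) * Real.exp t := by
    rw [Finset.sum_mul]
    refine Finset.sum_le_sum fun j _ => ?_
    rw [← Real.exp_add]
    exact Real.exp_le_exp.2 (by have := (abs_le.1 (h j)).1; linarith)
  rw [div_mul_eq_mul_div, div_le_div_iff₀ hS hS']
  calc Real.exp (u i) * ∑ j, Real.exp (u' j)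
      ≤ (Real.exp (u' i) * Real.exp t) * ((∑ j, Real.exp (u j)) * Real.exp t) :=
        mul_le_mul h1 h2 hS'.le (by positivity)
    _ = Real.exp (u' i) * Real.exp (2 * t) * ∑ j, Real.exp (u j) := by
        rw [two_mul, Real.exp_add]; ring

lemma aux_gauss (m m' v v' y r ε M v0 : ℝ) (hv0 : 0 < v0) (hr : 0 ≤ r) (hε : 0 ≤ ε) (hM : 0 ≤ M)
    (hv : v0 ≤ v) (hv' : v0 ≤ v') (hm : |m| ≤ M * (1 + r)) (hm' : |m'| ≤ M * (1 + r))
    (hmm : |m - m'| ≤ ε * (1 + r)) (hvv : |v - v'| ≤ ε) :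
    gaussPDF m v y ≤ gaussPDF m' v' y *
      Real.exp (ε * ((1 / v0 + (1 + M) / v0 + (1 + M ^ 2) / v0 ^ 2) *
        ((1 + r) ^ 2 * (1 + y ^ 2)))) := by
  have hvp : 0 < v := hv0.trans_le hv
  have hvp' : 0 < v' := hv0.trans_le hv'
  set W := (1 + r) ^ 2 * (1 + y ^ 2) with hW
  have hR1 : 1 ≤ 1 + r := by linarith
  have hR2 : 1 + r ≤ (1 + r) ^ 2 := by nlinarith
  have hW1 : 1 ≤ W := by nlinarith [sq_nonneg y]
  have hWy : (1 + r) * |y| ≤ W := by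
    have h1 : |y| ≤ 1 + y ^ 2 := by nlinarith [sq_abs y, abs_nonneg y, sq_nonneg (|y| - 1)]
    rw [hW]; exact mul_le_mul hR2 h1 (abs_nonneg _) (by positivity)
  have hWr : (1 + r) ^ 2 ≤ W := by rw [hW]; nlinarith [sq_nonneg y, sq_nonneg (1 + r), mul_nonneg (sq_nonneg (1+r)) (sq_nonneg y)]
  have hWyy : y ^ 2 ≤ W := by rw [hW]; nlinarith [sq_nonneg y]
  have hpi := Real.pi_pos
  -- the normalising factor
  have hnorm : (Real.sqrt (2 * Real.pi * v))⁻¹ ≤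
      (Real.sqrt (2 * Real.pi * v'))⁻¹ * Real.exp (ε * (1 / v0 * W)) := by
    have h1 : v' ≤ v * Real.exp (ε / v0) := by
      have h2 : 1 + ε / v0 ≤ Real.exp (ε / v0) := by
        have := Real.add_one_le_exp (ε / v0); linarith
      have h3 : v' ≤ v + ε := by have := (abs_le.1 hvv).1; linarith
      have h4 : ε ≤ v * (ε / v0) := by
        rw [mul_div_assoc', le_div_iff₀ hv0]; nlinarith
      nlinarith
    have h5 : Real.exp (ε / v0) ≤ Real.exp (ε * (1 / v0 * W)) ^ 2 := by
      rw [← Real.exp_nat_mul]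
      apply Real.exp_le_exp.2
      have : ε / v0 ≤ ε / v0 * W := le_mul_of_one_le_right (by positivity) hW1
      have e : ((2:ℕ):ℝ) * (ε * (1 / v0 * W)) = 2 * (ε / v0 * W) := by push_cast; ring
      rw [e]
      have : 0 ≤ ε / v0 := by positivity
      linarith
    have h6 : Real.sqrt (2 * Real.pi * v') ≤
        Real.sqrt (2 * Real.pi * v) * Real.exp (ε * (1 / v0 * W)) := by
      rw [← Real.sqrt_sq (Real.exp_pos (ε * (1 / v0 * W))).le, ← Real.sqrt_mul (by positivity)]
      apply Real.sqrt_le_sqrt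
      calc 2 * Real.pi * v' ≤ 2 * Real.pi * (v * Real.exp (ε / v0)) := by gcongr
        _ ≤ 2 * Real.pi * (v * Real.exp (ε * (1 / v0 * W)) ^ 2) := by gcongr
        _ = _ := by ring
    have p1 : 0 < Real.sqrt (2 * Real.pi * v) := Real.sqrt_pos.2 (by positivity)
    have p2 : 0 < Real.sqrt (2 * Real.pi * v') := Real.sqrt_pos.2 (by positivity)
    rw [inv_mul_eq_div, inv_eq_one_div, div_le_div_iff₀ p1 p2]
    linarith
  have hexp : -(y - m) ^ 2 / (2 * v) ≤ -(y - m') ^ 2 / (2 * v') +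
      ε * (((1 + M) / v0 + (1 + M ^ 2) / v0 ^ 2) * W) := by
    have key : (y - m') ^ 2 / (2 * v') - (y - m) ^ 2 / (2 * v) =
        (m - m') * (2 * y - m - m') / (2 * v') + (y - m) ^ 2 * (v - v') / (2 * v * v') := by
      field_simp; ring
    have b1 : (m - m') * (2 * y - m - m') / (2 * v') ≤ ε * ((1 + M) / v0 * W) := by
      have c1 : |2 * y - m - m'| ≤ 2 * (|y| + M * (1 + r)) := by
        rw [abs_le]; have := abs_le.1 hm; have := abs_le.1 hm'
        have := neg_abs_le y; have := le_abs_self y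
        constructor <;> linarith
      have c2 : (m - m') * (2 * y - m - m') ≤ ε * (1 + r) * (2 * (|y| + M * (1 + r))) :=
        (le_abs_self _).trans (by
          rw [abs_mul]; exact mul_le_mul hmm c1 (abs_nonneg _) (by positivity))
      have c3 : (1 + r) * (|y| + M * (1 + r)) ≤ (1 + M) * W := by nlinarith
      rw [div_le_iff₀ (by positivity)]
      have c4 : ε * (1 + r) * (2 * (|y| + M * (1 + r))) ≤ 2 * (ε * ((1 + M) * W)) := by
        nlinarith
      have c5 : ε * ((1 + M) / v0 * W) * (2 * v') = 2 * (ε * ((1 + M) * W)) * (v' / v0) := by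
        field_simp
      have c6 : 1 ≤ v' / v0 := by rw [le_div_iff₀ hv0]; linarith
      rw [c5]
      refine c2.trans (c4.trans (le_mul_of_one_le_right (by positivity) c6))
    have b2 : (y - m) ^ 2 * (v - v') / (2 * v * v') ≤ ε * ((1 + M ^ 2) / v0 ^ 2 * W) := by
      have c1 : (y - m) ^ 2 ≤ 2 * ((1 + M ^ 2) * W) := by
        have d1 : m ^ 2 ≤ M ^ 2 * (1 + r) ^ 2 := by
          rw [← sq_abs m, ← mul_pow]; exact pow_le_pow_left₀ (abs_nonneg _) hm 2
        have d2 : M ^ 2 * (1 + r) ^ 2 ≤ M ^ 2 * W := by gcongr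
        nlinarith [sq_nonneg (y + m)]
      have c2 : (y - m) ^ 2 * (v - v') ≤ 2 * ((1 + M ^ 2) * W) * ε := by
        have := (abs_le.1 hvv).2
        calc (y - m) ^ 2 * (v - v') ≤ (y - m) ^ 2 * ε := by gcongr
          _ ≤ _ := by gcongr
      rw [div_le_iff₀ (by positivity)]
      have c5 : ε * ((1 + M ^ 2) / v0 ^ 2 * W) * (2 * v * v') =
          2 * ((1 + M ^ 2) * W) * ε * (v / v0 * (v' / v0)) := by field_simp
      have c6 : 1 ≤ v' / v0 := by rw [le_div_iff₀ hv0]; linarith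
      have c7 : 1 ≤ v / v0 := by rw [le_div_iff₀ hv0]; linarith
      rw [c5]
      exact c2.trans (le_mul_of_one_le_right (by positivity) (one_le_mul_of_one_le_of_one_le c7 c6))
    have e : ε * (((1 + M) / v0 + (1 + M ^ 2) / v0 ^ 2) * W) =
      ε * ((1 + M) / v0 * W) + ε * ((1 + M ^ 2) / v0 ^ 2 * W) := by ring
    rw [e, neg_div, neg_div]
    linarith
  unfold gaussPDF
  have := Real.exp_le_exp.2 hexp
  calc _ ≤ ((Real.sqrt (2 * Real.pi * v'))⁻¹ * Real.exp (ε * (1 / v0 * W))) *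
      Real.exp (-(y - m') ^ 2 / (2 * v') +
      ε * (((1 + M) / v0 + (1 + M ^ 2) / v0 ^ 2) * W)) :=
        mul_le_mul hnorm this (Real.exp_pos _).le (by positivity)
    _ = _ := by
      have e : ε * ((1 / v0 + (1 + M) / v0 + (1 + M ^ 2) / v0 ^ 2) * W) = ε * (1 / v0 * W) +
        ε * (((1 + M) / v0 + (1 + M ^ 2) / v0 ^ 2) * W) := by ring
      rw [e, Real.exp_add, Real.exp_add]
      ring

lemma gaussPDF_pos {m v : ℝ} (hv : 0 < v) (y : ℝ) : 0 < gaussPDF m v y := by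
  have := Real.pi_pos
  unfold gaussPDF
  positivity

lemma pSS_pos {d K k : ℕ} (P : HMoE d (K + 1) k) (hk : 1 ≤ k) (hν : ∀ i j, 0 < P.ν i j)
    (x : Euc d) (y : ℝ) : 0 < pSS P x y := by
  have : Nonempty (Fin k) := ⟨⟨0, hk⟩⟩
  unfold pSS
  refine Finset.sum_pos (fun i _ => mul_pos (div_pos (Real.exp_pos _)
    (Finset.sum_pos (fun j _ => Real.exp_pos _) Finset.univ_nonempty)) ?_) Finset.univ_nonempty
  exact Finset.sum_pos (fun j _ => mul_pos (div_pos (Real.exp_pos _)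
    (Finset.sum_pos (fun j _ => Real.exp_pos _) Finset.univ_nonempty))
    (gaussPDF_pos (hν i j) y)) Finset.univ_nonempty

/-- The tuple of parameters of expert `(i, j)`. -/
def tup {d k1 k2 : ℕ} (P : HMoE d k1 k2) (i1 : Fin k1) (i2 : Fin k2) :
    ℝ × Euc d × ℝ × Euc d × Euc d × ℝ × ℝ :=
  (P.b i1, P.a i1, P.β i1 i2, P.ω i1 i2, P.η i1 i2, P.τ i1 i2, P.ν i1 i2)

lemma aux_inner {d : ℕ} (a a' x : Euc d) (b b' ε : ℝ) (ha : ‖a - a'‖ ≤ ε) (hb : |b - b'| ≤ ε) :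
    |(⟪a, x⟫ + b) - (⟪a', x⟫ + b')| ≤ ε * (1 + ‖x‖) := by
  have h : (⟪a, x⟫ + b) - (⟪a', x⟫ + b') = ⟪a - a', x⟫ + (b - b') := by
    rw [inner_sub_left]; ring
  rw [h]
  have h2 := (abs_real_inner_le_norm (a - a') x).trans
    (mul_le_mul_of_nonneg_right ha (norm_nonneg x))
  have := abs_add_le (⟪a - a', x⟫) (b - b')
  linarith

lemma aux_lip {d K k : ℕ} (P P' : HMoE d (K + 1) k) (M v0 ε : ℝ) (hv0 : 0 < v0) (hε : 0 ≤ ε)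
    (hM : 0 ≤ M) (hv : ∀ i j, v0 ≤ P.ν i j) (hv' : ∀ i j, v0 ≤ P'.ν i j)
    (hb : ∀ i j, ‖tup P i j‖ ≤ M) (hb' : ∀ i j, ‖tup P' i j‖ ≤ M)
    (hd : ∀ i j, ‖tup P i j - tup P' i j‖ ≤ ε) (x : Euc d) (y : ℝ) (hk : 1 ≤ k) :
    pSS P x y ≤ pSS P' x y * Real.exp (ε * ((4 + (1 / v0 + (1 + M) / v0 + (1 + M ^ 2) / v0 ^ 2)) *
        ((1 + ‖x‖) ^ 2 * (1 + y ^ 2)))) := by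
  set C := 1 / v0 + (1 + M) / v0 + (1 + M ^ 2) / v0 ^ 2 with hC
  set W := (1 + ‖x‖) ^ 2 * (1 + y ^ 2) with hW
  have hW1 : (1 + ‖x‖) ≤ W := by
    have := norm_nonneg x
    rw [hW]; nlinarith [sq_nonneg y, mul_nonneg (sq_nonneg (1 + ‖x‖)) (sq_nonneg y)]
  set t := ε * (1 + ‖x‖) with ht
  simp only [tup, Prod.norm_def, Prod.fst_sub, Prod.snd_sub, max_le_iff, Real.norm_eq_abs] at hb hb' hd
  have hbd : ∀ (a : Euc d) (b : ℝ), ‖a‖ ≤ M → |b| ≤ M → |⟪a, x⟫ + b| ≤ M * (1 + ‖x‖) := by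
    intro a b h1 h2
    have := aux_inner a 0 x b 0 M (by simpa using h1) (by simpa using h2)
    simpa using this
  have hE : Real.exp (2 * t) * (Real.exp (2 * t) * Real.exp (ε * (C * W))) ≤
      Real.exp (ε * ((4 + C) * W)) := by
    rw [← Real.exp_add, ← Real.exp_add]
    apply Real.exp_le_exp.2
    have : t ≤ ε * W := by rw [ht]; gcongr
    linarith
  have j0 : Fin k := ⟨0, hk⟩
  unfold pSS
  rw [Finset.sum_mul]
  refine Finset.sum_le_sum fun i _ => ?_
  have s1 := aux_softmax (fun i => ⟪P.a i, x⟫ + P.b i) (fun i => ⟪P'.a i, x⟫ + P'.b i) t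
    (fun i => aux_inner _ _ _ _ _ _ (hd i j0).2.1 (hd i j0).1) i
  have s2 : (∑ i2, (Real.exp (⟪P.ω i i2, x⟫ + P.β i i2) /
        ∑ j2, Real.exp (⟪P.ω i j2, x⟫ + P.β i j2)) *
      gaussPDF (⟪P.η i i2, x⟫ + P.τ i i2) (P.ν i i2) y) ≤
      (∑ i2, (Real.exp (⟪P'.ω i i2, x⟫ + P'.β i i2) /
        ∑ j2, Real.exp (⟪P'.ω i j2, x⟫ + P'.β i j2)) *
      gaussPDF (⟪P'.η i i2, x⟫ + P'.τ i i2) (P'.ν i i2) y) *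
      (Real.exp (2 * t) * Real.exp (ε * (C * W))) := by
    rw [Finset.sum_mul]
    refine Finset.sum_le_sum fun j _ => ?_
    have s3 := aux_softmax (fun j => ⟪P.ω i j, x⟫ + P.β i j) (fun j => ⟪P'.ω i j, x⟫ + P'.β i j) t
      (fun j => aux_inner _ _ _ _ _ _ (hd i j).2.2.2.1 (hd i j).2.2.1) j
    have s4 := aux_gauss (⟪P.η i j, x⟫ + P.τ i j) (⟪P'.η i j, x⟫ + P'.τ i j) (P.ν i j) (P'.ν i j)
      y ‖x‖ ε M v0 hv0 (norm_nonneg _) hε hM (hv i j) (hv' i j)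
      (hbd _ _ (hb i j).2.2.2.2.1 (hb i j).2.2.2.2.2.1)
      (hbd _ _ (hb' i j).2.2.2.2.1 (hb' i j).2.2.2.2.2.1)
      (aux_inner _ _ _ _ _ _ (hd i j).2.2.2.2.1 (hd i j).2.2.2.2.2.1) (hd i j).2.2.2.2.2.2
    refine (mul_le_mul s3 s4 (gaussPDF_pos (hv0.trans_le (hv i j)) y).le (by positivity)).trans
      (le_of_eq ?_)
    ring
  have hpos : 0 ≤ ∑ i2, (Real.exp (⟪P.ω i i2, x⟫ + P.β i i2) /
        ∑ j2, Real.exp (⟪P.ω i j2, x⟫ + P.β i j2)) *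
      gaussPDF (⟪P.η i i2, x⟫ + P.τ i i2) (P.ν i i2) y :=
    Finset.sum_nonneg fun j _ => mul_nonneg (by positivity)
      (gaussPDF_pos (hv0.trans_le (hv i j)) y).le
  have hpos' : 0 ≤ ∑ i2, (Real.exp (⟪P'.ω i i2, x⟫ + P'.β i i2) /
        ∑ j2, Real.exp (⟪P'.ω i j2, x⟫ + P'.β i j2)) *
      gaussPDF (⟪P'.η i i2, x⟫ + P'.τ i i2) (P'.ν i i2) y :=
    Finset.sum_nonneg fun j _ => mul_nonneg (by positivity)
      (gaussPDF_pos (hv0.trans_le (hv' i j)) y).le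
  refine (mul_le_mul s1 s2 hpos (by positivity)).trans ?_
  calc _ = (Real.exp (⟪P'.a i, x⟫ + P'.b i) / ∑ j1, Real.exp (⟪P'.a j1, x⟫ + P'.b j1)) *
    (∑ i2, (Real.exp (⟪P'.ω i i2, x⟫ + P'.β i i2) /
        ∑ j2, Real.exp (⟪P'.ω i j2, x⟫ + P'.β i j2)) *
      gaussPDF (⟪P'.η i i2, x⟫ + P'.τ i i2) (P'.ν i i2) y) *
      (Real.exp (2 * t) * (Real.exp (2 * t) * Real.exp (ε * (C * W)))) := by ring
    _ ≤ _ := by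
      refine mul_le_mul_of_nonneg_left hE ?_
      exact mul_nonneg (by positivity) hpos'

lemma pSS_measurable {d k1 k2 : ℕ} (P : HMoE d k1 k2) :
    Measurable fun z : Euc d × ℝ => pSS P z.1 z.2 := by
  unfold pSS gaussPDF
  fun_prop

lemma gaussPDF_eq (m : ℝ) (w : NNReal) :
    gaussPDF m w = ProbabilityTheory.gaussianPDFReal m w := by
  funext y
  rfl

lemma gaussPDF_integrable {m v : ℝ} (hv : 0 < v) : Integrable (gaussPDF m v) := by
  lift v to NNReal using hv.le
  rw [gaussPDF_eq]; exact ProbabilityTheory.integrable_gaussianPDFReal _ _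

lemma gaussPDF_integral {m v : ℝ} (hv : 0 < v) : ∫ y, gaussPDF m v y = 1 := by
  lift v to NNReal using hv.le
  rw [gaussPDF_eq]
  exact ProbabilityTheory.integral_gaussianPDFReal_eq_one _ (by exact_mod_cast hv.ne')

lemma gaussPDF_moment {m v : ℝ} (hv : 0 < v) :
    ∫⁻ y, ENNReal.ofReal ((1 + y ^ 2) * gaussPDF m v y) = ENNReal.ofReal (1 + (v + m ^ 2)) := by
  lift v to NNReal using hv.le
  have hne : v ≠ 0 := by exact_mod_cast hv.ne'
  have h2 : MemLp id 2 (ProbabilityTheory.gaussianReal m v) :=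
    ProbabilityTheory.memLp_id_gaussianReal' 2 (by simp)
  have hvar := ProbabilityTheory.variance_eq_sub h2
  rw [ProbabilityTheory.variance_id_gaussianReal] at hvar
  have hI : Integrable (fun y : ℝ => y ^ 2) (ProbabilityTheory.gaussianReal m v) := by
    simpa using h2.integrable_sq
  have hm : ∫ y, y ^ 2 ∂(ProbabilityTheory.gaussianReal m v) = v + m ^ 2 := by
    have e1 : (∫ y, (id : ℝ → ℝ) y ∂(ProbabilityTheory.gaussianReal m v)) = m := by
      simp
    have e2 : ((id : ℝ → ℝ) ^ 2) = fun y => y ^ 2 := rfl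
    rw [e1, e2] at hvar
    linarith
  have hI1 : Integrable (fun y : ℝ => 1 + y ^ 2) (ProbabilityTheory.gaussianReal m v) :=
    (integrable_const 1).add hI
  have hm1 : ∫ y, (1 + y ^ 2) ∂(ProbabilityTheory.gaussianReal m v) = 1 + (v + m ^ 2) := by
    rw [integral_add (integrable_const 1) hI, hm]; simp
  rw [← hm1, ofReal_integral_eq_lintegral_ofReal hI1 (Filter.Eventually.of_forall fun y => by
    show (0:ℝ) ≤ 1 + y ^ 2
    positivity),
    ProbabilityTheory.gaussianReal_of_var_ne_zero _ hne,
    lintegral_withDensity_eq_lintegral_mul _ (by fun_prop) (by fun_prop)]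
  refine lintegral_congr fun y => ?_
  rw [Pi.mul_apply, ProbabilityTheory.gaussianPDF, ← gaussPDF_eq,
    ← ENNReal.ofReal_mul (gaussPDF_pos hv y).le, mul_comm]

lemma pSS_integrable {d K k : ℕ} (P : HMoE d (K + 1) k) (hν : ∀ i j, 0 < P.ν i j) (x : Euc d) :
    Integrable (pSS P x) := by
  unfold pSS
  exact integrable_finsetSum _ fun i _ => (integrable_finsetSum _ fun j _ =>
    (gaussPDF_integrable (hν i j)).const_mul _).const_mul _

lemma pSS_integral {d K k : ℕ} (P : HMoE d (K + 1) k) (hk : 1 ≤ k) (hν : ∀ i j, 0 < P.ν i j)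
    (x : Euc d) : ∫ y, pSS P x y = 1 := by
  have : Nonempty (Fin k) := ⟨⟨0, hk⟩⟩
  unfold pSS
  rw [integral_finsetSum _ fun i _ => (integrable_finsetSum _ fun j _ =>
    (gaussPDF_integrable (hν i j)).const_mul _).const_mul _]
  have h : ∀ i : Fin (K + 1), ∫ y, (Real.exp (⟪P.a i, x⟫ + P.b i) /
      ∑ j1, Real.exp (⟪P.a j1, x⟫ + P.b j1)) *
    ∑ i2, (Real.exp (⟪P.ω i i2, x⟫ + P.β i i2) /
        ∑ j2, Real.exp (⟪P.ω i j2, x⟫ + P.β i j2)) *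
      gaussPDF (⟪P.η i i2, x⟫ + P.τ i i2) (P.ν i i2) y = (Real.exp (⟪P.a i, x⟫ + P.b i) /
      ∑ j1, Real.exp (⟪P.a j1, x⟫ + P.b j1)) := by
    intro i
    rw [integral_const_mul, integral_finsetSum _ fun j _ =>
      (gaussPDF_integrable (hν i j)).const_mul _]
    simp_rw [integral_const_mul, gaussPDF_integral (hν i _), mul_one]
    rw [← Finset.sum_div, div_self, mul_one]
    exact (Finset.sum_pos (fun j _ => Real.exp_pos _) Finset.univ_nonempty).ne'
  simp_rw [h]
  rw [← Finset.sum_div, div_self]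
  exact (Finset.sum_pos (fun j _ => Real.exp_pos _) Finset.univ_nonempty).ne'

lemma aux_affinity (p q : ℝ → ℝ) (hp : Integrable p) (hq : Integrable q) (hp0 : ∀ y, 0 ≤ p y)
    (hq0 : ∀ y, 0 ≤ q y) (hp1 : ∫ y, p y = 1) (hq1 : ∫ y, q y = 1) :
    ∫⁻ y, ENNReal.ofReal (Real.sqrt (p y) * Real.sqrt (q y)) =
      ENNReal.ofReal (1 - hellingerDist p q ^ 2) ∧ hellingerDist p q ^ 2 ≤ 1 := by
  have hle : ∀ y, Real.sqrt (p y) * Real.sqrt (q y) ≤ p y + q y := by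
    intro y
    have h1 := Real.sq_sqrt (hp0 y)
    have h2 := Real.sq_sqrt (hq0 y)
    nlinarith [sq_nonneg (Real.sqrt (p y) - Real.sqrt (q y)), hp0 y, hq0 y]
  have hI : Integrable fun y => Real.sqrt (p y) * Real.sqrt (q y) := by
    refine (hp.add hq).mono' ?_ (Filter.Eventually.of_forall fun y => ?_)
    · exact (Real.continuous_sqrt.comp_aestronglyMeasurable hp.1).mul
        (Real.continuous_sqrt.comp_aestronglyMeasurable hq.1)
    · rw [Real.norm_of_nonneg (by positivity)]; exact hle y
  have hs : ∀ y, (Real.sqrt (p y) - Real.sqrt (q y)) ^ 2 =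
      (p y + q y) - 2 * (Real.sqrt (p y) * Real.sqrt (q y)) := by
    intro y
    have h1 := Real.sq_sqrt (hp0 y)
    have h2 := Real.sq_sqrt (hq0 y)
    nlinarith
  have hnn : 0 ≤ ∫ y, (Real.sqrt (p y) - Real.sqrt (q y)) ^ 2 :=
    integral_nonneg fun y => sq_nonneg _
  have hh : hellingerDist p q ^ 2 = 1 - ∫ y, Real.sqrt (p y) * Real.sqrt (q y) := by
    unfold hellingerDist
    rw [Real.sq_sqrt (by positivity)]
    simp_rw [hs]
    rw [integral_sub (f := fun y => p y + q y) (hp.add hq) (hI.const_mul 2), integral_const_mul, integral_add hp hq, hp1, hq1]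
    ring
  have h0 : 0 ≤ ∫ y, Real.sqrt (p y) * Real.sqrt (q y) :=
    integral_nonneg fun y => by positivity
  refine ⟨?_, by linarith⟩
  rw [hh, sub_sub_cancel, ofReal_integral_eq_lintegral_ofReal hI
    (Filter.Eventually.of_forall fun y => by
      show 0 ≤ Real.sqrt (p y) * Real.sqrt (q y)
      positivity)]

lemma joint_lintegral {d k1 k2 : ℕ} (μ : Measure (Euc d)) [IsProbabilityMeasure μ]
    (P : HMoE d k1 k2) (f : Euc d × ℝ → ENNReal) (hf : Measurable f) :
    ∫⁻ z, f z ∂(jointMeasure μ (pSS P)) =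
      ∫⁻ x, (∫⁻ y, ENNReal.ofReal (pSS P x y) * f (x, y)) ∂μ := by
  have hm := (pSS_measurable P).ennreal_ofReal
  unfold jointMeasure
  rw [lintegral_withDensity_eq_lintegral_mul _ hm hf, lintegral_prod _ (hm.mul hf).aemeasurable]
  rfl

lemma joint_prob {d K k : ℕ} (μ : Measure (Euc d)) [IsProbabilityMeasure μ]
    (P : HMoE d (K + 1) k) (hk : 1 ≤ k) (hν : ∀ i j, 0 < P.ν i j) :
    IsProbabilityMeasure (jointMeasure μ (pSS P)) := by
  constructor
  have h := joint_lintegral μ P (fun _ => 1) measurable_const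
  rw [lintegral_one] at h
  rw [h]
  simp only [mul_one]
  have : ∀ x, ∫⁻ y, ENNReal.ofReal (pSS P x y) = 1 := by
    intro x
    rw [← ofReal_integral_eq_lintegral_ofReal (pSS_integrable P hν x)
      (Filter.Eventually.of_forall fun y => (pSS_pos P hk hν x y).le), pSS_integral P hk hν x]
    simp
  simp [this]

lemma joint_affinity {d K k k' : ℕ} (μ : Measure (Euc d)) [IsProbabilityMeasure μ]
    (P : HMoE d (K + 1) k) (hk : 1 ≤ k) (hν : ∀ i j, 0 < P.ν i j)
    (Q : HMoE d (K + 1) k') (hk' : 1 ≤ k') (hν' : ∀ i j, 0 < Q.ν i j) (δ : ℝ) (hδ : 0 ≤ δ)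
    (hlt : δ < ∫ x, hellingerDist (pSS Q x) (pSS P x) ∂μ) :
    ∫⁻ z, ENNReal.ofReal (Real.sqrt (pSS Q z.1 z.2 / pSS P z.1 z.2)) ∂(jointMeasure μ (pSS P)) ≤
      ENNReal.ofReal (Real.exp (-δ ^ 2)) := by
  have hmeas : Measurable fun z : Euc d × ℝ =>
      ENNReal.ofReal (Real.sqrt (pSS Q z.1 z.2 / pSS P z.1 z.2)) :=
    ((pSS_measurable Q).div (pSS_measurable P)).sqrt.ennreal_ofReal
  rw [joint_lintegral μ P _ hmeas]
  set h : Euc d → ℝ := fun x => hellingerDist (pSS Q x) (pSS P x) with hh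
  have hI : Integrable h μ := by
    by_contra hc
    rw [integral_undef hc] at hlt
    linarith
  have haff := fun x => aux_affinity (pSS Q x) (pSS P x) (pSS_integrable Q hν' x)
    (pSS_integrable P hν x) (fun y => (pSS_pos Q hk' hν' x y).le)
    (fun y => (pSS_pos P hk hν x y).le) (pSS_integral Q hk' hν' x) (pSS_integral P hk hν x)
  have hinner : ∀ x, ∫⁻ y, ENNReal.ofReal (pSS P x y) *
      ENNReal.ofReal (Real.sqrt (pSS Q x y / pSS P x y)) = ENNReal.ofReal (1 - h x ^ 2) := by
    intro x
    rw [hh, ← (haff x).1]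
    refine lintegral_congr fun y => ?_
    have hp := pSS_pos P hk hν x y
    rw [← ENNReal.ofReal_mul hp.le, Real.sqrt_div (pSS_pos Q hk' hν' x y).le]
    congr 1
    have h1 := Real.mul_self_sqrt hp.le
    have h2 := (Real.sqrt_pos.2 hp).ne'
    field_simp
    rw [Real.sq_sqrt hp.le]; ring
  simp only [hinner]
  have h0 : ∀ x, 0 ≤ h x := fun x => Real.sqrt_nonneg _
  have hsq : ∀ x, h x ^ 2 ≤ 1 := fun x => (haff x).2
  have hI2 : Integrable (fun x => h x ^ 2) μ := by
    refine (integrable_const (1:ℝ)).mono' (hI.1.pow 2) (Filter.Eventually.of_forall fun x => ?_)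
    rw [Real.norm_of_nonneg (by positivity)]
    exact hsq x
  rw [← ofReal_integral_eq_lintegral_ofReal (f := fun x => 1 - h x ^ 2)
    ((integrable_const (1:ℝ)).sub hI2)
    (Filter.Eventually.of_forall fun x => sub_nonneg.2 (hsq x))]
  apply ENNReal.ofReal_le_ofReal
  rw [integral_sub (integrable_const (1:ℝ)) hI2]
  have hJ : (∫ x, h x ∂μ) * (2 * δ) - δ ^ 2 ≤ ∫ x, h x ^ 2 ∂μ := by
    have : ∫ x, (h x * (2 * δ) - δ ^ 2) ∂μ ≤ ∫ x, h x ^ 2 ∂μ :=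
      integral_mono ((hI.mul_const _).sub (integrable_const _)) hI2
        (fun x => by have := sq_nonneg (h x - δ); simp only; nlinarith)
    rw [integral_sub (hI.mul_const _) (integrable_const _), integral_mul_const] at this
    simpa using this
  have := Real.add_one_le_exp (-δ ^ 2)
  simp only [integral_const, probReal_univ, smul_eq_mul, mul_one]
  nlinarith

lemma joint_moment {d K k : ℕ} (μ : Measure (Euc d)) [IsProbabilityMeasure μ]
    (P : HMoE d (K + 1) k) (M R : ℝ) (hM : 0 ≤ M) (hR0 : 0 ≤ R)
    (hν : ∀ i j, 0 < P.ν i j) (hb : ∀ i j, ‖tup P i j‖ ≤ M)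
    (hR : ∀ᵐ x ∂μ, ‖x‖ ≤ R) :
    ∃ K0 : ℝ, 0 ≤ K0 ∧
      ∫⁻ z, ENNReal.ofReal ((1 + ‖z.1‖) ^ 2 * (1 + z.2 ^ 2)) ∂(jointMeasure μ (pSS P)) ≤
        ENNReal.ofReal K0 := by
  simp only [tup, Prod.norm_def, max_le_iff, Real.norm_eq_abs] at hb
  set B := 1 + (M + (M * (1 + R)) ^ 2) with hB
  have hB0 : 0 ≤ B := by positivity
  refine ⟨(1 + R) ^ 2 * ∑ _i : Fin (K + 1), ∑ _j : Fin k, B, by positivity, ?_⟩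
  have hmeas : Measurable fun z : Euc d × ℝ =>
      ENNReal.ofReal ((1 + ‖z.1‖) ^ 2 * (1 + z.2 ^ 2)) := by fun_prop
  rw [joint_lintegral μ P _ hmeas]
  have hx : ∀ᵐ x ∂μ, (∫⁻ y, ENNReal.ofReal (pSS P x y) *
      ENNReal.ofReal ((1 + ‖x‖) ^ 2 * (1 + y ^ 2))) ≤
      ENNReal.ofReal ((1 + R) ^ 2 * ∑ _i : Fin (K + 1), ∑ _j : Fin k, B) := by
    filter_upwards [hR] with x hx
    have hpw : ∀ y, ENNReal.ofReal (pSS P x y) *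
      ENNReal.ofReal ((1 + ‖x‖) ^ 2 * (1 + y ^ 2)) ≤ ENNReal.ofReal ((1 + R) ^ 2) *
        ∑ i, ∑ j, ENNReal.ofReal ((1 + y ^ 2) * gaussPDF (⟪P.η i j, x⟫ + P.τ i j) (P.ν i j) y) := by
      intro y
      have hg : ∀ i j, 0 ≤ gaussPDF (⟪P.η i j, x⟫ + P.τ i j) (P.ν i j) y :=
        fun i j => (gaussPDF_pos (hν i j) y).le
      have h1 : pSS P x y ≤ ∑ i, ∑ j, gaussPDF (⟪P.η i j, x⟫ + P.τ i j) (P.ν i j) y := by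
        unfold pSS
        refine Finset.sum_le_sum fun i _ => ?_
        have hs : ∀ {n : ℕ} (u : Fin n → ℝ) (i : Fin n),
            Real.exp (u i) / ∑ j, Real.exp (u j) ≤ 1 := fun u i =>
          div_le_one_of_le₀ (Finset.single_le_sum (f := fun j => Real.exp (u j))
            (fun j _ => (Real.exp_pos _).le) (Finset.mem_univ i))
            (Finset.sum_nonneg fun j _ => (Real.exp_pos _).le)
        refine (mul_le_of_le_one_left (Finset.sum_nonneg fun j _ =>
          mul_nonneg (by positivity) (hg i j)) (hs (fun i => ⟪P.a i, x⟫ + P.b i) i)).trans ?_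
        refine Finset.sum_le_sum fun j _ => ?_
        exact mul_le_of_le_one_left (hg i j) (hs (fun j => ⟪P.ω i j, x⟫ + P.β i j) j)
      have h2 : (0:ℝ) ≤ 1 + y ^ 2 := by positivity
      simp_rw [← ENNReal.ofReal_sum_of_nonneg (fun j _ => mul_nonneg h2 (hg _ j))]
      rw [← ENNReal.ofReal_sum_of_nonneg (fun i _ => Finset.sum_nonneg fun j _ =>
        mul_nonneg h2 (hg i j)), ← ENNReal.ofReal_mul (p := (1 + R) ^ 2) (by positivity),
        ← ENNReal.ofReal_mul' (q := (1 + ‖x‖) ^ 2 * (1 + y ^ 2)) (by positivity)]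
      apply ENNReal.ofReal_le_ofReal
      simp_rw [← Finset.mul_sum]
      have h3 : (1 + ‖x‖) ^ 2 ≤ (1 + R) ^ 2 := by gcongr
      have h4 : 0 ≤ ∑ i, ∑ j, gaussPDF (⟪P.η i j, x⟫ + P.τ i j) (P.ν i j) y :=
        Finset.sum_nonneg fun i _ => Finset.sum_nonneg fun j _ => hg i j
      calc _ ≤ (∑ i, ∑ j, gaussPDF (⟪P.η i j, x⟫ + P.τ i j) (P.ν i j) y) *
            ((1 + R) ^ 2 * (1 + y ^ 2)) := by gcongr
        _ = _ := by ring
    refine (lintegral_mono hpw).trans ?_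
    have hgm : ∀ i j, Measurable fun y : ℝ =>
        ENNReal.ofReal ((1 + y ^ 2) * gaussPDF (⟪P.η i j, x⟫ + P.τ i j) (P.ν i j) y) := by
      intro i j; unfold gaussPDF; fun_prop
    rw [lintegral_const_mul _ (Finset.measurable_fun_sum _ fun i _ =>
      Finset.measurable_fun_sum _ fun j _ => hgm i j),
      lintegral_finsetSum _ (fun i _ => Finset.measurable_fun_sum _ fun j _ => hgm i j),
      ENNReal.ofReal_mul (by positivity),
      ENNReal.ofReal_sum_of_nonneg (fun i _ => by positivity)]
    gcongr with i _
    rw [lintegral_finsetSum _ (fun j _ => hgm i j),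
      ENNReal.ofReal_sum_of_nonneg (fun i _ => by positivity)]
    gcongr with j _
    rw [gaussPDF_moment (hν i j)]
    apply ENNReal.ofReal_le_ofReal
    have h1 : P.ν i j ≤ M := (le_abs_self _).trans (hb i j).2.2.2.2.2.2
    have h2 : |⟪P.η i j, x⟫ + P.τ i j| ≤ M * (1 + R) := by
      have := aux_inner (P.η i j) 0 x (P.τ i j) 0 M (by simpa using (hb i j).2.2.2.2.1)
        (by simpa using (hb i j).2.2.2.2.2.1)
      simp only [inner_zero_left, add_zero, sub_zero] at this
      exact this.trans (by gcongr)
    have h3 := pow_le_pow_left₀ (abs_nonneg _) h2 2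
    rw [sq_abs] at h3
    linarith
  refine (lintegral_mono_ae hx).trans ?_
  simp

/-- Product of iid nonnegative variables. -/
lemma pi_lintegral_prod {Z : Type*} [MeasurableSpace Z] (Q : Measure Z) [IsProbabilityMeasure Q]
    (n : ℕ) (f : Z → ENNReal) (hf : Measurable f) :
    ∫⁻ s, ∏ i, f (s i) ∂(Measure.pi fun _ : Fin n => Q) = (∫⁻ z, f z ∂Q) ^ n := by
  have hind : ProbabilityTheory.iIndepFun (fun (i : Fin n) (s : Fin n → Z) => f (s i))
      (Measure.pi fun _ : Fin n => Q) :=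
    ProbabilityTheory.iIndepFun_pi (X := fun _ => f) (fun i => hf.aemeasurable)
  rw [ProbabilityTheory.lintegral_prod_eq_prod_lintegral_of_indepFun _ _ hind
    (fun i => hf.comp (measurable_pi_apply i))]
  have : ∀ i : Fin n, ∫⁻ s, f (s i) ∂(Measure.pi fun _ : Fin n => Q) = ∫⁻ z, f z ∂Q := fun i =>
    (measurePreserving_eval (fun _ : Fin n => Q) i).lintegral_comp hf
  simp [this]

lemma pi_lintegral_sum {Z : Type*} [MeasurableSpace Z] (Q : Measure Z) [IsProbabilityMeasure Q]
    (n : ℕ) (f : Z → ENNReal) (hf : Measurable f) :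
    ∫⁻ s, ∑ i, f (s i) ∂(Measure.pi fun _ : Fin n => Q) = n * (∫⁻ z, f z ∂Q) := by
  rw [lintegral_finsetSum (f := fun (i : Fin n) (s : Fin n → Z) => f (s i)) _
    (fun i _ => hf.comp (measurable_pi_apply i))]
  have : ∀ i : Fin n, ∫⁻ s, f (s i) ∂(Measure.pi fun _ : Fin n => Q) = ∫⁻ z, f z ∂Q := fun i =>
    (measurePreserving_eval (fun _ : Fin n => Q) i).lintegral_comp hf
  simp [this]

/-- Polynomial covering of bounded sets in finite dimension. -/
lemma aux_cover {E : Type*} [NormedAddCommGroup E] [NormedSpace ℝ E] [FiniteDimensional ℝ E]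
    (S : Set E) (M : ℝ) (hS : ∀ θ ∈ S, ‖θ‖ ≤ M) :
    ∃ (m B : ℕ) (C0 : ℝ), 0 ≤ C0 ∧ ∀ n : ℕ, 1 ≤ n →
      ∃ κ : E → (Fin m → Fin (2 * (B * n ^ 2) + 1)), ∀ θ ∈ S, ∀ θ' ∈ S, κ θ = κ θ' →
        ‖θ - θ'‖ ≤ C0 / n ^ 2 := by
  let φ : E ≃L[ℝ] (Fin (Module.finrank ℝ E) → ℝ) := ContinuousLinearEquiv.ofFinrankEq (by simp)
  obtain ⟨B, hB⟩ := exists_nat_ge (‖(φ : E →L[ℝ] (Fin (Module.finrank ℝ E) → ℝ))‖ * M)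
  refine ⟨Module.finrank ℝ E, B, ‖(φ.symm : (Fin (Module.finrank ℝ E) → ℝ) →L[ℝ] E)‖, norm_nonneg _, fun n hn => ?_⟩
  refine ⟨fun θ i => Fin.ofNat _ (⌊φ θ i * n ^ 2⌋ + B * n ^ 2).toNat, ?_⟩
  have hn0 : (0:ℝ) < (n:ℝ) ^ 2 := by positivity
  have hbd : ∀ θ ∈ S, ∀ i, |φ θ i| ≤ B := by
    intro θ hθ i
    have h1 : ‖φ θ i‖ ≤ ‖φ θ‖ := norm_le_pi_norm _ i
    have h2 : ‖φ θ‖ ≤ ‖(φ : E →L[ℝ] (Fin (Module.finrank ℝ E) → ℝ))‖ * ‖θ‖ := (φ : E →L[ℝ] (Fin (Module.finrank ℝ E) → ℝ)).le_opNorm θ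
    have h3 : ‖(φ : E →L[ℝ] (Fin (Module.finrank ℝ E) → ℝ))‖ * ‖θ‖ ≤ ‖(φ : E →L[ℝ] (Fin (Module.finrank ℝ E) → ℝ))‖ * M := by gcongr; exact hS θ hθ
    rw [← Real.norm_eq_abs]; linarith
  have hfl : ∀ θ ∈ S, ∀ i, 0 ≤ ⌊φ θ i * n ^ 2⌋ + (B * n ^ 2 : ℤ) ∧
      ⌊φ θ i * n ^ 2⌋ + (B * n ^ 2 : ℤ) ≤ 2 * (B * n ^ 2) := by
    intro θ hθ i
    have h := abs_le.1 (hbd θ hθ i)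
    constructor
    · have : (-(B * n ^ 2) : ℤ) ≤ ⌊φ θ i * n ^ 2⌋ := by
        rw [Int.le_floor]; push_cast; nlinarith
      linarith
    · have : ⌊φ θ i * n ^ 2⌋ ≤ (B * n ^ 2 : ℤ) := by
        have h5 : (⌊φ θ i * n ^ 2⌋ : ℝ) ≤ B * n ^ 2 := (Int.floor_le _).trans (by nlinarith)
        exact_mod_cast h5
      linarith
  intro θ hθ θ' hθ' heq
  have hcoord : ∀ i, |φ θ i - φ θ' i| ≤ 1 / (n:ℝ) ^ 2 := by
    intro i
    have h1 := congrArg Fin.val (congrFun heq i)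
    simp only [Fin.val_ofNat] at h1
    have a1 := hfl θ hθ i
    have a2 := hfl θ' hθ' i
    rw [Nat.mod_eq_of_lt (by zify; rw [Int.toNat_of_nonneg a1.1]; linarith),
      Nat.mod_eq_of_lt (by zify; rw [Int.toNat_of_nonneg a2.1]; linarith)] at h1
    have h2 : ⌊φ θ i * n ^ 2⌋ = ⌊φ θ' i * n ^ 2⌋ := by
      zify at h1
      rw [Int.toNat_of_nonneg a1.1, Int.toNat_of_nonneg a2.1] at h1
      linarith
    have h3 := Int.abs_sub_lt_one_of_floor_eq_floor h2
    rw [← sub_mul, abs_mul, abs_of_pos hn0] at h3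
    rw [le_div_iff₀ hn0]
    exact h3.le
  have h1 : ‖φ θ - φ θ'‖ ≤ 1 / (n:ℝ) ^ 2 := by
    rw [pi_norm_le_iff_of_nonneg (by positivity)]
    intro i
    exact hcoord i
  have h2 : θ - θ' = (φ.symm : (Fin (Module.finrank ℝ E) → ℝ) →L[ℝ] E) (φ θ - φ θ') := by simp
  rw [h2]
  refine ((φ.symm : (Fin (Module.finrank ℝ E) → ℝ) →L[ℝ] E).le_opNorm _).trans ?_
  rw [div_eq_mul_one_div]
  gcongr

/-- Density estimation rate for the MLE in the Softmax–Softmax Gaussian HMoE: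
under (A.1)–(A.4), any maximum likelihood estimator `Ĝₙ` over `𝒢_{k₁*,k₂}(Θ)` (with
`k₂ > k₂*`) satisfies
`ℙ( E_X[h(p^SS_{Ĝₙ}(·|X), p^SS_{G*}(·|X))] > C₁ √(log n / n) ) ≤ C₂ exp(−c₁ log n)`
for all `n ≥ 2`, for universal constants `C₁, c₁, C₂ > 0`. -/
theorem mle_density_rate_SS {d K1 K2 : ℕ} (k2 : ℕ)
    (Θ : Set (ℝ × Euc d × ℝ × Euc d × Euc d × ℝ × ℝ))
    -- (A.1): compact parameter space (with positive variances), bounded input support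
    (hΘ : IsCompact Θ)
    (hΘν : ∀ θ ∈ Θ, 0 < θ.2.2.2.2.2.2)
    (μ : Measure (Euc d)) [IsProbabilityMeasure μ]
    (hμ : ∃ s : Set (Euc d), Bornology.IsBounded s ∧ μ sᶜ = 0)
    -- true mixing measure, with k₁* = K1 + 1 groups and k₂* = K2 + 1 experts per group
    (Gs : HMoE d (K1 + 1) (K2 + 1))
    (hGs : inParamSpace Θ Gs)
    (hk2 : K2 + 1 < k2)
    -- (A.2): normalization for identifiability
    (hA2a : Gs.a (Fin.last K1) = 0) (hA2b : Gs.b (Fin.last K1) = 0)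
    (hA2ω : ∀ i1, Gs.ω i1 (Fin.last K2) = 0) (hA2β : ∀ i1, Gs.β i1 (Fin.last K2) = 0)
    -- (A.3): distinct expert parameters within each group
    (hA3 : ∀ i1, Function.Injective fun i2 => (Gs.η i1 i2, Gs.τ i1 i2, Gs.ν i1 i2))
    -- (A.4): input-dependent gating
    (hA4a : ∃ i1, Gs.a i1 ≠ 0) (hA4ω : ∃ i1 i2, Gs.ω i1 i2 ≠ 0)
    -- the estimator: a maximizer of the empirical log-likelihood over 𝒢_{k₁*,k₂}(Θ)
    (Ghat : (n : ℕ) → (Fin n → Euc d × ℝ) → Candidate d (K1 + 1))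
    (hMLE : ∀ (n : ℕ) (s : Fin n → Euc d × ℝ),
      Ghat n s ∈ candClass d (K1 + 1) k2 Θ ∧
      ∀ G ∈ candClass d (K1 + 1) k2 Θ,
        (1 / (n : ℝ)) * ∑ i, Real.log (pSS G.2 (s i).1 (s i).2) ≤
          (1 / (n : ℝ)) * ∑ i, Real.log (pSS (Ghat n s).2 (s i).1 (s i).2)) :
    ∃ C1 c1 C2 : ℝ, 0 < C1 ∧ 0 < c1 ∧ 0 < C2 ∧
      ∀ n : ℕ, 2 ≤ n →
        (Measure.pi fun _ : Fin n => jointMeasure μ (pSS Gs))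
            {s | C1 * Real.sqrt (Real.log n / n) <
              ∫ x, hellingerDist (pSS (Ghat n s).2 x) (pSS Gs x) ∂μ} ≤
          ENNReal.ofReal (C2 * Real.exp (-(c1 * Real.log n))) := by
  have hνP : ∀ {k : ℕ} (P : HMoE d (K1 + 1) k), inParamSpace Θ P → ∀ i j, 0 < P.ν i j :=
    fun P hP i j => hΘν _ (hP i j)
  have hθ0 : tup Gs 0 0 ∈ Θ := hGs 0 0
  obtain ⟨M, hM⟩ := hΘ.isBounded.exists_norm_le
  have hM0 : 0 ≤ M := (norm_nonneg _).trans (hM _ hθ0)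
  obtain ⟨θm, hθm, hmin⟩ := hΘ.exists_isMinOn ⟨_, hθ0⟩
    (f := fun θ => θ.2.2.2.2.2.2) (by fun_prop)
  set v0 := θm.2.2.2.2.2.2 with hv0def
  have hv0 : 0 < v0 := hΘν _ hθm
  have hv : ∀ {k : ℕ} (P : HMoE d (K1 + 1) k), inParamSpace Θ P → ∀ i j, v0 ≤ P.ν i j :=
    fun P hP i j => hmin (hP i j)
  obtain ⟨S, hSb, hS0⟩ := hμ
  obtain ⟨R', hR'⟩ := hSb.exists_norm_le
  have hR : ∀ᵐ x ∂μ, ‖x‖ ≤ max R' 0 := by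
    have : ∀ᵐ x ∂μ, x ∈ S := hS0
    filter_upwards [this] with x hx
    exact (hR' x hx).trans (le_max_left _ _)
  obtain ⟨K0, hK0, hmom⟩ := joint_moment μ Gs M (max R' 0) hM0 (le_max_right _ _) (hνP Gs hGs)
    (fun i j => hM _ (hGs i j)) hR
  obtain ⟨m, B, C0, hC0, hcov⟩ := aux_cover Θ M hM
  set L := 4 + (1 / v0 + (1 + M) / v0 + (1 + M ^ 2) / v0 ^ 2) with hL
  have hL0 : 0 ≤ L := by positivity
  set K := C0 * L * (K0 + 1) with hK
  set D0 := m * k2 * (K1 + 1) with hD0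
  set A : ℝ := (k2 + 1) * (2 * B + 1) ^ D0 with hA
  have hA0 : 0 ≤ A := by positivity
  have : IsProbabilityMeasure (jointMeasure μ (pSS Gs)) :=
    joint_prob μ Gs (by omega) (hνP Gs hGs)
  refine ⟨Real.sqrt (2 * D0 + 1), 1, 1 + A * Real.exp (K / 2), by positivity, one_pos,
    by positivity, fun n hn => ?_⟩
  have hn1 : (1:ℝ) ≤ n := by exact_mod_cast (by omega : 1 ≤ n)
  have hn0 : (0:ℝ) < n := by linarith
  have hlog : 0 ≤ Real.log n := Real.log_nonneg hn1
  set δ := Real.sqrt (2 * D0 + 1) * Real.sqrt (Real.log n / n) with hδ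
  have hδ0 : 0 ≤ δ := by positivity
  have hδsq : n * δ ^ 2 = (2 * D0 + 1) * Real.log n := by
    rw [hδ, mul_pow, Real.sq_sqrt (by positivity), Real.sq_sqrt (by positivity)]
    field_simp
  obtain ⟨κ, hκ⟩ := hcov n (by omega)
  set ε := C0 / (n:ℝ) ^ 2 with hε
  have hε0 : 0 ≤ ε := by positivity
  let T : Euc d × ℝ → ℝ := fun z => (1 + ‖z.1‖) ^ 2 * (1 + z.2 ^ 2)
  have hT0 : ∀ z, 0 ≤ T z := fun z => by simp only [T]; positivity
  have hTm : Measurable T := by simp only [T]; fun_prop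
  set ℙ := Measure.pi fun _ : Fin n => jointMeasure μ (pSS Gs) with hℙ
  -- the tail event
  set E1 : Set (Fin n → Euc d × ℝ) := {s | (n:ℝ) ^ 2 * (K0 + 1) ≤ ∑ i, T (s i)} with hE1
  have hPE1 : ℙ E1 ≤ ENNReal.ofReal (1 / n) := by
    have hsub : E1 ⊆ {s | ENNReal.ofReal ((n:ℝ) ^ 2 * (K0 + 1)) ≤
        ∑ i, ENNReal.ofReal (T (s i))} := by
      intro s hs
      rw [Set.mem_ofPred_eq, ← ENNReal.ofReal_sum_of_nonneg (fun i _ => hT0 _)]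
      exact ENNReal.ofReal_le_ofReal hs
    refine (measure_mono hsub).trans ?_
    have hpos : 0 < (n:ℝ) ^ 2 * (K0 + 1) := by positivity
    refine (meas_ge_le_lintegral_div ?_ (ENNReal.ofReal_pos.2 hpos).ne' ENNReal.ofReal_ne_top).trans ?_
    · exact (Finset.measurable_fun_sum _ fun i _ =>
        (hTm.comp (measurable_pi_apply i)).ennreal_ofReal).aemeasurable
    rw [hℙ, pi_lintegral_sum _ _ (fun z => ENNReal.ofReal (T z)) hTm.ennreal_ofReal]
    calc _ ≤ (n : ENNReal) * ENNReal.ofReal K0 / ENNReal.ofReal ((n:ℝ) ^ 2 * (K0 + 1)) := by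
          gcongr
      _ = ENNReal.ofReal (n * K0 / ((n:ℝ) ^ 2 * (K0 + 1))) := by
          rw [ENNReal.ofReal_div_of_pos hpos, ENNReal.ofReal_mul hn0.le, ENNReal.ofReal_natCast]
      _ ≤ _ := by
          apply ENNReal.ofReal_le_ofReal
          rw [div_le_div_iff₀ hpos hn0]
          nlinarith
  -- codes
  let code : Candidate d (K1 + 1) → Fin (k2 + 1) ×
      (Fin (K1 + 1) → Fin k2 → Fin m → Fin (2 * (B * n ^ 2) + 1)) := fun c =>
    (Fin.ofNat _ c.1, fun i j => if h : j.1 < c.1 then κ (tup c.2 i ⟨j.1, h⟩) else κ 0)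
  have hcode : ∀ w, ∃ Ew : Set (Fin n → Euc d × ℝ),
      ℙ Ew ≤ ENNReal.ofReal (Real.exp (K / 2) * Real.exp (-((2 * D0 + 1) * Real.log n))) ∧
      ∀ c ∈ candClass d (K1 + 1) k2 Θ, δ < ∫ x, hellingerDist (pSS c.2 x) (pSS Gs x) ∂μ →
        code c = w → ∀ s : Fin n → Euc d × ℝ,
          ∑ i, Real.log (pSS Gs (s i).1 (s i).2) ≤ ∑ i, Real.log (pSS c.2 (s i).1 (s i).2) →
          ∑ i, T (s i) ≤ (n:ℝ) ^ 2 * (K0 + 1) → s ∈ Ew := by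
    intro w
    by_cases hw : ∃ c ∈ candClass d (K1 + 1) k2 Θ,
        δ < ∫ x, hellingerDist (pSS c.2 x) (pSS Gs x) ∂μ ∧ code c = w
    swap
    · refine ⟨∅, by simp, fun c hc h1 h2 => ?_⟩
      exact absurd ⟨c, hc, h1, h2⟩ hw
    obtain ⟨⟨k, Q⟩, ⟨hk1, hkk, hQ⟩, hQδ, hQw⟩ := hw
    simp only at hk1 hkk hQ hQδ
    have hQpos := pSS_pos Q hk1 (hνP Q hQ)
    have hGpos := pSS_pos Gs (by omega) (hνP Gs hGs)
    let g : Euc d × ℝ → ENNReal := fun z =>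
      ENNReal.ofReal (Real.sqrt (pSS Q z.1 z.2 / pSS Gs z.1 z.2))
    have hg : Measurable g :=
      ((pSS_measurable Q).div (pSS_measurable Gs)).sqrt.ennreal_ofReal
    refine ⟨{s | ENNReal.ofReal (Real.exp (-(K / 2))) ≤ ∏ i, g (s i)}, ?_, ?_⟩
    · refine (meas_ge_le_lintegral_div ?_ (ENNReal.ofReal_pos.2 (Real.exp_pos _)).ne'
        ENNReal.ofReal_ne_top).trans ?_
      · exact (Finset.measurable_fun_prod _ fun i _ =>
          hg.comp (measurable_pi_apply i)).aemeasurable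
      rw [hℙ, pi_lintegral_prod _ _ g hg]
      have haff := joint_affinity μ Gs (by omega) (hνP Gs hGs) Q hk1 (hνP Q hQ) δ hδ0 hQδ
      calc _ ≤ ENNReal.ofReal (Real.exp (-δ ^ 2)) ^ n /
            ENNReal.ofReal (Real.exp (-(K / 2))) := by
            gcongr
        _ = ENNReal.ofReal (Real.exp (-δ ^ 2) ^ n / Real.exp (-(K / 2))) := by
            rw [ENNReal.ofReal_div_of_pos (Real.exp_pos _), ENNReal.ofReal_pow (Real.exp_pos _).le]
        _ = _ := by
            congr 1
            rw [← Real.exp_nat_mul, ← Real.exp_sub, ← Real.exp_add]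
            congr 1
            linarith
    · rintro ⟨k', P⟩ ⟨hk1', hkk', hP⟩ - hPw s hmle hTs
      simp only at hk1' hkk' hP hmle
      rw [← hQw] at hPw
      have hfst := congrArg Fin.val (congrArg Prod.fst hPw)
      simp only [code, Fin.val_ofNat] at hfst
      rw [Nat.mod_eq_of_lt (by omega), Nat.mod_eq_of_lt (by omega)] at hfst
      subst hfst
      have hPpos := pSS_pos P hk1' (hνP P hP)
      have hd : ∀ i j, ‖tup P i j - tup Q i j‖ ≤ ε := by
        intro i j
        have h1 := congrFun (congrFun (congrArg Prod.snd hPw) i) ⟨j.1, by omega⟩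
        simp only [code, j.2, dif_pos] at h1
        exact hκ _ (hP i j) _ (hQ i j) h1
      have hlip := fun x y => aux_lip P Q M v0 ε hv0 hε0 hM0 (hv P hP) (hv Q hQ)
        (fun i j => hM _ (hP i j)) (fun i j => hM _ (hQ i j)) hd x y hk1'
      have hll : ∀ z : Euc d × ℝ, Real.log (pSS P z.1 z.2) ≤
          Real.log (pSS Q z.1 z.2) + ε * (L * T z) := by
        intro z
        have := Real.log_le_log (hPpos z.1 z.2) (hlip z.1 z.2)
        rwa [Real.log_mul (hQpos _ _).ne' (Real.exp_pos _).ne', Real.log_exp] at this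
      show _ ≤ ∏ i, ENNReal.ofReal _
      rw [← ENNReal.ofReal_prod_of_nonneg (fun i _ => Real.sqrt_nonneg _)]
      apply ENNReal.ofReal_le_ofReal
      have hprodpos : 0 < ∏ i, Real.sqrt (pSS Q (s i).1 (s i).2 / pSS Gs (s i).1 (s i).2) :=
        Finset.prod_pos fun i _ => Real.sqrt_pos.2 (div_pos (hQpos _ _) (hGpos _ _))
      rw [← Real.le_log_iff_exp_le hprodpos, Real.log_prod fun i _ =>
        (Real.sqrt_pos.2 (div_pos (hQpos (s i).1 (s i).2) (hGpos (s i).1 (s i).2))).ne']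
      have hterm : ∀ i, Real.log (Real.sqrt (pSS Q (s i).1 (s i).2 / pSS Gs (s i).1 (s i).2)) =
          (Real.log (pSS Q (s i).1 (s i).2) - Real.log (pSS Gs (s i).1 (s i).2)) / 2 := by
        intro i
        rw [Real.log_sqrt (div_pos (hQpos _ _) (hGpos _ _)).le,
          Real.log_div (hQpos _ _).ne' (hGpos _ _).ne']
      simp_rw [hterm]
      rw [← Finset.sum_div, Finset.sum_sub_distrib]
      have hsum : ∑ i, Real.log (pSS P (s i).1 (s i).2) ≤
          ∑ i, Real.log (pSS Q (s i).1 (s i).2) + ε * (L * ∑ i, T (s i)) := by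
        rw [Finset.mul_sum, Finset.mul_sum, ← Finset.sum_add_distrib]
        exact Finset.sum_le_sum fun i _ => hll (s i)
      have hKb : ε * (L * ∑ i, T (s i)) ≤ K := by
        calc ε * (L * ∑ i, T (s i)) ≤ ε * (L * ((n:ℝ) ^ 2 * (K0 + 1))) := by gcongr
          _ = K := by rw [hε, hK]; field_simp
      linarith
  choose Ew hEw1 hEw2 using hcode
  have hsub : {s | δ < ∫ x, hellingerDist (pSS (Ghat n s).2 x) (pSS Gs x) ∂μ} ⊆
      E1 ∪ ⋃ w, Ew w := by
    intro s hs
    by_cases h1 : s ∈ E1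
    · exact Or.inl h1
    refine Or.inr (Set.mem_iUnion.2 ⟨code (Ghat n s), ?_⟩)
    refine hEw2 _ (Ghat n s) (hMLE n s).1 hs rfl s ?_ (not_le.1 h1).le
    have h2 := (hMLE n s).2 ⟨K2 + 1, Gs⟩ ⟨by simp, hk2.le, hGs⟩
    exact le_of_mul_le_mul_left h2 (by positivity)
  refine (measure_mono hsub).trans ((measure_union_le _ _).trans ?_)
  have hU : ℙ (⋃ w, Ew w) ≤ ENNReal.ofReal (A * Real.exp (K / 2) * (1 / n)) := by
    refine (measure_iUnion_fintype_le ℙ Ew).trans ((Finset.sum_le_sum fun w _ => hEw1 w).trans ?_)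
    rw [Finset.sum_const, nsmul_eq_mul, ← ENNReal.ofReal_natCast,
      ← ENNReal.ofReal_mul (Nat.cast_nonneg _)]
    apply ENNReal.ofReal_le_ofReal
    have hcard : ((Finset.univ : Finset (Fin (k2 + 1) ×
      (Fin (K1 + 1) → Fin k2 → Fin m → Fin (2 * (B * n ^ 2) + 1)))).card : ℝ) ≤
        A * (n:ℝ) ^ (2 * D0) := by
      have e : (Finset.univ : Finset (Fin (k2 + 1) ×
        (Fin (K1 + 1) → Fin k2 → Fin m → Fin (2 * (B * n ^ 2) + 1)))).card =
          (k2 + 1) * (2 * (B * n ^ 2) + 1) ^ D0 := by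
        simp [Fintype.card_prod, ← pow_mul, hD0]
      rw [e, hA]
      push_cast
      rw [mul_assoc, pow_mul (n:ℝ) 2 D0, ← mul_pow]
      gcongr
      nlinarith [one_le_pow₀ hn1 (n := 2)]
    have hexp : Real.exp (-((2 * D0 + 1) * Real.log n)) = 1 / ((n:ℝ) ^ (2 * D0) * n) := by
      have : ((2 * D0 + 1) * Real.log n : ℝ) = ((2 * D0 + 1 : ℕ) : ℝ) * Real.log n := by
        push_cast; ring
      rw [Real.exp_neg, this, Real.exp_nat_mul, Real.exp_log hn0, one_div, pow_succ]
    rw [hexp]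
    have hnp : 0 < (n:ℝ) ^ (2 * D0) := by positivity
    calc _ ≤ A * (n:ℝ) ^ (2 * D0) * (Real.exp (K / 2) * (1 / ((n:ℝ) ^ (2 * D0) * n))) := by gcongr
      _ = _ := by field_simp
  refine (add_le_add hPE1 hU).trans ?_
  rw [← ENNReal.ofReal_add (by positivity) (by positivity)]
  apply ENNReal.ofReal_le_ofReal
  rw [one_mul, Real.exp_neg, Real.exp_log hn0, ← one_div]
  apply le_of_eq
  ring
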